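/- Let n ≥ 1 and let f : ℝⁿ → ℝ be a C² function with f(x) ≥ 0 for all x and Δf(x) ≥ 0 for all x, where Δ is the Euclidean Laplacian (the sum of second directional derivatives along the standard orthonormal basis). If ∫_{ℝⁿ} f(x)^p dx < ∞ for some real p with 1 < p < ∞, then f = 0 identically. -/

import Mathlib

open MeasureTheory

/-- The Euclidean Laplacian of a map `f : ℝⁿ → F`: the sum of the second
directional derivatives along the standard orthonormal basis of `ℝⁿ`. -/
noncomputable def eLap {n : ℕ} {F : Type*} [NormedAddCommGroup F] [NormedSpace ℝ F]
    (f : EuclideanSpace ℝ (Fin n) → F) (x : EuclideanSpace ℝ (Fin n)) : F :=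
  ∑ i : Fin n,
    fderiv ℝ (fderiv ℝ f) x (EuclideanSpace.single i 1) (EuclideanSpace.single i 1)

open Filter Topology

theorem hasDerivAt_max_zero_sq (u : ℝ) :
    HasDerivAt (fun u : ℝ => max u 0 ^ 2) (2 * max u 0) u := by
  have key : ∀ v ≠ (0 : ℝ), HasDerivAt (fun u : ℝ => max u 0 ^ 2) (2 * max v 0) v := by
    intro v hv
    rcases lt_or_gt_of_ne hv with h | h
    · rw [max_eq_right h.le, mul_zero]
      refine (hasDerivAt_const v (0 : ℝ)).congr_of_eventuallyEq ?_
      filter_upwards [Iio_mem_nhds h] with w hw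
      simp [max_eq_right (Set.mem_Iio.1 hw).le]
    · rw [max_eq_left h.le]
      have h2 : HasDerivAt (fun u : ℝ => u ^ 2) (2 * v) v := by
        simpa using hasDerivAt_pow 2 v
      refine h2.congr_of_eventuallyEq ?_
      filter_upwards [Ioi_mem_nhds h] with w hw
      simp [max_eq_left (Set.mem_Ioi.1 hw).le]
  rcases eq_or_ne u 0 with rfl | hu
  · exact hasDerivAt_of_hasDerivAt_of_ne (g := fun v => 2 * max v 0) key
      (by fun_prop) (by fun_prop)
  · exact key u hu

section Bump

variable {E : Type*} [NormedAddCommGroup E]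

/-- The truncated paraboloid `max (1 - ‖y‖²) 0`. -/
noncomputable def paraboloidBump (y : E) : ℝ := max (1 - ‖y‖ ^ 2) 0

theorem continuous_paraboloidBump : Continuous (paraboloidBump : E → ℝ) := by
  unfold paraboloidBump
  fun_prop

theorem paraboloidBump_nonneg (y : E) : 0 ≤ paraboloidBump y := le_max_right _ _

theorem paraboloidBump_le_one (y : E) : paraboloidBump y ≤ 1 :=
  max_le (by nlinarith [sq_nonneg ‖y‖]) zero_le_one

theorem paraboloidBump_eq_zero {y : E} (hy : 1 ≤ ‖y‖) : paraboloidBump y = 0 :=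
  max_eq_right (by nlinarith)

theorem hasCompactSupport_paraboloidBump [ProperSpace E] :
    HasCompactSupport (paraboloidBump : E → ℝ) := by
  refine HasCompactSupport.intro (isCompact_closedBall (0 : E) 1) fun y hy => ?_
  exact paraboloidBump_eq_zero (not_le.1 (by simpa using hy)).le

theorem hasFDerivAt_paraboloidBump_sq [InnerProductSpace ℝ E] (y : E) :
    HasFDerivAt (fun y : E => paraboloidBump y ^ 2 / 4)
      (-(paraboloidBump y • innerSL ℝ y)) y := by
  have h1 : HasFDerivAt (fun y : E => 1 - ‖y‖ ^ 2) (-(2 • innerSL ℝ y)) y := by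
    simpa using (hasStrictFDerivAt_norm_sq y).hasFDerivAt.const_sub 1
  have h2 := ((hasDerivAt_max_zero_sq (1 - ‖y‖ ^ 2)).comp_hasFDerivAt y h1).mul_const (1 / 4 : ℝ)
  convert! h2 using 1
  · ext z
    simp [paraboloidBump, div_eq_mul_inv]
  · ext z
    simp [paraboloidBump]
    ring

end Bump

section Mean

variable {n : ℕ} {f : EuclideanSpace ℝ (Fin n) → ℝ}

/-- Green's identity for a dilate of `f` against the truncated paraboloid. -/
theorem integral_fderiv_dilate_mul_paraboloidBump (hf : ContDiff ℝ 2 f)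
    (x : EuclideanSpace ℝ (Fin n)) (t : ℝ) :
    ∫ y, fderiv ℝ f (x + t • y) y * paraboloidBump y =
      t * ∫ y, eLap f (x + t • y) * (paraboloidBump y ^ 2 / 4) := by
  have hd1 : ContDiff ℝ 1 (fderiv ℝ f) := hf.fderiv_right (by norm_num)
  have hc1 : Continuous (fderiv ℝ f) := hd1.continuous
  have hc2 : Continuous (fderiv ℝ (fderiv ℝ f)) := hd1.continuous_fderiv (by norm_num)
  have hcψ := continuous_paraboloidBump (E := EuclideanSpace ℝ (Fin n))
  have hsψ := hasCompactSupport_paraboloidBump (E := EuclideanSpace ℝ (Fin n))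
  have hsΨ : HasCompactSupport fun y : EuclideanSpace ℝ (Fin n) => paraboloidBump y ^ 2 / 4 :=
    hsψ.comp_left (g := fun s : ℝ => s ^ 2 / 4) (by norm_num)
  have hΨ' : ∀ (y : EuclideanSpace ℝ (Fin n)) (i : Fin n),
      fderiv ℝ (fun y : EuclideanSpace ℝ (Fin n) => paraboloidBump y ^ 2 / 4) y
        (EuclideanSpace.single i 1) = -(y i * paraboloidBump y) := by
    intro y i
    rw [(hasFDerivAt_paraboloidBump_sq y).fderiv]
    simp [EuclideanSpace.inner_single_right]
    ring
  have hg : ∀ (i : Fin n) (y : EuclideanSpace ℝ (Fin n)),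
      HasFDerivAt (fun y => fderiv ℝ f (x + t • y) (EuclideanSpace.single i 1))
        ((ContinuousLinearMap.apply ℝ ℝ (EuclideanSpace.single i (1 : ℝ))).comp
          ((fderiv ℝ (fderiv ℝ f) (x + t • y)).comp
            (t • ContinuousLinearMap.id ℝ (EuclideanSpace ℝ (Fin n))))) y := by
    intro i y
    have ha : HasFDerivAt (fun y : EuclideanSpace ℝ (Fin n) => x + t • y)
        (t • ContinuousLinearMap.id ℝ (EuclideanSpace ℝ (Fin n))) y :=
      ((hasFDerivAt_id y).const_smul t).const_add x
    have hb := ((hd1.differentiable (by norm_num)) (x + t • y)).hasFDerivAt.comp y ha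
    exact (ContinuousLinearMap.apply ℝ ℝ
      (EuclideanSpace.single i (1 : ℝ))).hasFDerivAt.comp y hb
  have hg' : ∀ (i : Fin n) (y : EuclideanSpace ℝ (Fin n)),
      fderiv ℝ (fun y => fderiv ℝ f (x + t • y) (EuclideanSpace.single i 1)) y
        (EuclideanSpace.single i 1) =
      t * fderiv ℝ (fderiv ℝ f) (x + t • y) (EuclideanSpace.single i 1)
        (EuclideanSpace.single i 1) := by
    intro i y
    rw [(hg i y).fderiv]
    simp
  have hint1 : ∀ i : Fin n, Integrable fun y : EuclideanSpace ℝ (Fin n) =>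
      fderiv ℝ f (x + t • y) (EuclideanSpace.single i 1) * (y i * paraboloidBump y) := by
    intro i
    refine Continuous.integrable_of_hasCompactSupport (by fun_prop) ?_
    exact (hsψ.mul_left).mul_left
  have hint2 : ∀ i : Fin n, Integrable fun y : EuclideanSpace ℝ (Fin n) =>
      fderiv ℝ (fderiv ℝ f) (x + t • y) (EuclideanSpace.single i 1)
        (EuclideanSpace.single i 1) * (paraboloidBump y ^ 2 / 4) := by
    intro i
    refine Continuous.integrable_of_hasCompactSupport (by fun_prop) ?_
    exact hsΨ.mul_left
  have parts : ∀ i : Fin n,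
      ∫ y, fderiv ℝ f (x + t • y) (EuclideanSpace.single i 1) * (y i * paraboloidBump y) =
      t * ∫ y, fderiv ℝ (fderiv ℝ f) (x + t • y) (EuclideanSpace.single i 1)
        (EuclideanSpace.single i 1) * (paraboloidBump y ^ 2 / 4) := by
    intro i
    have h := integral_mul_fderiv_eq_neg_fderiv_mul_of_integrable (𝕜 := ℝ)
      (μ := (volume : Measure (EuclideanSpace ℝ (Fin n))))
      (f := fun y => fderiv ℝ f (x + t • y) (EuclideanSpace.single i 1))
      (g := fun y => paraboloidBump y ^ 2 / 4) (v := EuclideanSpace.single i 1)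
      (by simpa only [hg', mul_assoc] using (hint2 i).const_mul t)
      (by simpa only [hΨ', mul_neg, Pi.neg_def] using (hint1 i).neg)
      (Continuous.integrable_of_hasCompactSupport (by fun_prop) hsΨ.mul_left)
      (fun y _ => (hg i y).differentiableAt)
      (fun y _ => (hasFDerivAt_paraboloidBump_sq y).differentiableAt)
    simp only [hg', hΨ', mul_neg, integral_neg, neg_inj, mul_assoc, integral_const_mul] at h
    exact h
  have hexp : ∀ y : EuclideanSpace ℝ (Fin n), fderiv ℝ f (x + t • y) y * paraboloidBump y =
      ∑ i, fderiv ℝ f (x + t • y) (EuclideanSpace.single i 1) * (y i * paraboloidBump y) := by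
    intro y
    have hy : y = ∑ i, y i • EuclideanSpace.single i (1 : ℝ) := by
      simpa using ((EuclideanSpace.basisFun (Fin n) ℝ).sum_repr y).symm
    conv_lhs => rw [show fderiv ℝ f (x + t • y) y = fderiv ℝ f (x + t • y)
      (∑ i, y i • EuclideanSpace.single i (1 : ℝ)) from congrArg _ hy]
    rw [map_sum, Finset.sum_mul]
    refine Finset.sum_congr rfl fun i _ => ?_
    rw [map_smul, smul_eq_mul]
    ring
  simp only [hexp, eLap, Finset.sum_mul]
  rw [integral_finsetSum _ fun i _ => hint1 i, integral_finsetSum _ fun i _ => hint2 i,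
    Finset.mul_sum]
  exact Finset.sum_congr rfl fun i _ => parts i

theorem hasDerivAt_integral_dilate_mul_paraboloidBump (hf : ContDiff ℝ 1 f)
    (x : EuclideanSpace ℝ (Fin n)) (t : ℝ) :
    HasDerivAt (fun t : ℝ => ∫ y, f (x + t • y) * paraboloidBump y)
      (∫ y, fderiv ℝ f (x + t • y) y * paraboloidBump y) t := by
  have hc0 : Continuous f := hf.continuous
  have hc1 : Continuous (fderiv ℝ f) := hf.continuous_fderiv (by norm_num)
  have hcψ := continuous_paraboloidBump (E := EuclideanSpace ℝ (Fin n))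
  have hsψ := hasCompactSupport_paraboloidBump (E := EuclideanSpace ℝ (Fin n))
  have hcF : Continuous fun q : ℝ × EuclideanSpace ℝ (Fin n) =>
      fderiv ℝ f (x + q.1 • q.2) q.2 := by fun_prop
  obtain ⟨C, hC⟩ := ((isCompact_closedBall t 1).prod
    (isCompact_closedBall (0 : EuclideanSpace ℝ (Fin n)) 1)).exists_bound_of_continuousOn
      hcF.continuousOn
  refine (hasDerivAt_integral_of_dominated_loc_of_deriv_le
    (bound := fun y => C * paraboloidBump y)
    (F := fun (t : ℝ) (y : EuclideanSpace ℝ (Fin n)) => f (x + t • y) * paraboloidBump y)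
    (F' := fun (t : ℝ) (y : EuclideanSpace ℝ (Fin n)) =>
      fderiv ℝ f (x + t • y) y * paraboloidBump y)
    (Metric.closedBall_mem_nhds t zero_lt_one) ?_ ?_ ?_ ?_ ?_ ?_).2
  · exact Eventually.of_forall fun s => Continuous.aestronglyMeasurable (by fun_prop)
  · exact Continuous.integrable_of_hasCompactSupport (by fun_prop) hsψ.mul_left
  · exact Continuous.aestronglyMeasurable (by fun_prop)
  · refine Eventually.of_forall fun y s hs => ?_
    rw [norm_mul, Real.norm_of_nonneg (paraboloidBump_nonneg y)]
    rcases le_total 1 ‖y‖ with hy | hy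
    · simp [paraboloidBump_eq_zero hy]
    · exact mul_le_mul_of_nonneg_right (hC (s, y) ⟨hs, by simpa using hy⟩)
        (paraboloidBump_nonneg y)
  · exact (hcψ.integrable_of_hasCompactSupport hsψ).const_mul C
  · refine Eventually.of_forall fun y s _ => ?_
    have ha : HasDerivAt (fun s : ℝ => x + s • y) y s := by
      simpa using ((hasDerivAt_id s).smul_const y).const_add x
    exact (((hf.differentiable (by norm_num)) (x + s • y)).hasFDerivAt.comp_hasDerivAt s
      ha).mul_const _

/-- The sub-mean value inequality for the truncated paraboloid weight. -/
theorem mul_integral_paraboloidBump_le (hf : ContDiff ℝ 2 f) (hsub : ∀ x, 0 ≤ eLap f x)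
    (x : EuclideanSpace ℝ (Fin n)) {R : ℝ} (hR : 0 ≤ R) :
    f x * ∫ y : EuclideanSpace ℝ (Fin n), paraboloidBump y ≤
      ∫ y, f (x + R • y) * paraboloidBump y := by
  have hder := hasDerivAt_integral_dilate_mul_paraboloidBump (hf.of_le (by norm_num)) x
  have hmono : MonotoneOn (fun t : ℝ => ∫ y, f (x + t • y) * paraboloidBump y)
      (Set.Ici 0) := by
    refine monotoneOn_of_deriv_nonneg (convex_Ici 0)
      (fun t _ => (hder t).continuousAt.continuousWithinAt)
      (fun t _ => (hder t).differentiableAt.differentiableWithinAt) fun t ht => ?_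
    rw [interior_Ici] at ht
    rw [(hder t).deriv, integral_fderiv_dilate_mul_paraboloidBump hf]
    exact mul_nonneg (le_of_lt ht) (integral_nonneg fun y => mul_nonneg (hsub _) (by positivity))
  simpa [integral_const_mul] using hmono Set.self_mem_Ici hR hR

end Mean

theorem integral_paraboloidBump_pos (n : ℕ) :
    0 < ∫ y : EuclideanSpace ℝ (Fin n), paraboloidBump y :=
  continuous_paraboloidBump.integral_pos_of_hasCompactSupport_nonneg_nonzero
    hasCompactSupport_paraboloidBump paraboloidBump_nonneg (x := 0) (by simp [paraboloidBump])

theorem le_add_rpow_mul_rpow {a δ p : ℝ} (ha : 0 ≤ a) (hδ : 0 < δ) (hp : 1 ≤ p) :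
    a ≤ δ + δ ^ (1 - p) * a ^ p := by
  rcases le_total a δ with h | h
  · nlinarith [mul_nonneg (Real.rpow_nonneg hδ.le (1 - p)) (Real.rpow_nonneg ha p)]
  · have ha' : 0 < a := hδ.trans_le h
    have h1 : a ^ (1 - p) ≤ δ ^ (1 - p) :=
      Real.rpow_le_rpow_of_nonpos hδ h (by linarith)
    have h2 : a ^ (1 - p) * a ^ p = a := by
      rw [← Real.rpow_add ha']
      simp
    nlinarith [mul_le_mul_of_nonneg_right h1 (Real.rpow_nonneg ha p)]

/-- Yau's Liouville theorem on `ℝⁿ`. A nonnegative `C²`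
subharmonic function on `ℝⁿ` lying in `Lᵖ` for some `1 < p < ∞` vanishes
identically. -/
theorem yau_liouville_euclidean
    (n : ℕ) (hn : 1 ≤ n)
    (f : EuclideanSpace ℝ (Fin n) → ℝ)
    (hf : ContDiff ℝ 2 f)
    (hnn : ∀ x, 0 ≤ f x)
    (hsub : ∀ x, 0 ≤ eLap f x)
    (p : ℝ) (hp : 1 < p)
    (hLp : Integrable (fun x => f x ^ p) (volume : Measure (EuclideanSpace ℝ (Fin n)))) :
    ∀ x, f x = 0 := by
  have hcψ := continuous_paraboloidBump (E := EuclideanSpace ℝ (Fin n))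
  have hsψ := hasCompactSupport_paraboloidBump (E := EuclideanSpace ℝ (Fin n))
  have hc : Continuous f := hf.continuous
  have hcp : Continuous fun x => f x ^ p := hc.rpow_const fun _ => Or.inr (by linarith)
  intro x
  refine le_antisymm (le_of_forall_gt_imp_ge_of_dense fun δ hδ => ?_) (hnn x)
  set c := ∫ y : EuclideanSpace ℝ (Fin n), paraboloidBump y with hc_def
  have hcpos : 0 < c := integral_paraboloidBump_pos n
  set I := ∫ y, f y ^ p with hI
  have hbound : ∀ R : ℝ, 0 < R → f x * c ≤ δ * c + δ ^ (1 - p) * ((R ^ n)⁻¹ * I) := by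
    intro R hR
    have hδp := Real.rpow_nonneg hδ.le (1 - p)
    have hint : Integrable fun y : EuclideanSpace ℝ (Fin n) => f (x + R • y) ^ p :=
      (hLp.comp_add_left x).comp_smul hR.ne'
    have hval : ∫ y : EuclideanSpace ℝ (Fin n), f (x + R • y) ^ p = (R ^ n)⁻¹ * I := by
      rw [Measure.integral_comp_smul volume
        (fun z : EuclideanSpace ℝ (Fin n) => f (x + z) ^ p) R,
        integral_add_left_eq_self (fun z => f z ^ p) x, finrank_euclideanSpace_fin,
        abs_of_pos (by positivity), smul_eq_mul]
    calc f x * c ≤ ∫ y, f (x + R • y) * paraboloidBump y :=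
          mul_integral_paraboloidBump_le hf hsub x hR.le
      _ ≤ ∫ y, (δ * paraboloidBump y + δ ^ (1 - p) * f (x + R • y) ^ p) := by
          refine integral_mono
            (Continuous.integrable_of_hasCompactSupport (by fun_prop) hsψ.mul_left)
            (((hcψ.integrable_of_hasCompactSupport hsψ).const_mul δ).add
              (hint.const_mul _)) fun y => ?_
          have h1 := mul_le_mul_of_nonneg_right
            (le_add_rpow_mul_rpow (hnn (x + R • y)) hδ hp.le) (paraboloidBump_nonneg y)
          have h2 := mul_le_mul_of_nonneg_left (paraboloidBump_le_one y)
            (mul_nonneg hδp (Real.rpow_nonneg (hnn (x + R • y)) p))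
          dsimp only
          linarith
      _ = δ * c + δ ^ (1 - p) * ((R ^ n)⁻¹ * I) := by
          rw [integral_add ((hcψ.integrable_of_hasCompactSupport hsψ).const_mul δ)
            (hint.const_mul _), integral_const_mul, integral_const_mul, hval]
  have hlim : Tendsto (fun R : ℝ => δ * c + δ ^ (1 - p) * ((R ^ n)⁻¹ * I)) atTop
      (𝓝 (δ * c)) := by
    have h := (tendsto_pow_atTop (α := ℝ) (n := n) (by omega)).inv_tendsto_atTop
    simpa using ((h.mul_const I).const_mul (δ ^ (1 - p))).const_add (δ * c)
  have hle : f x * c ≤ δ * c :=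
    ge_of_tendsto hlim ((eventually_gt_atTop 0).mono hbound)
  exact le_of_mul_le_mul_right hle hcpos
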